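/- arXiv:2410.21277 — 2 statements merged into one kernel-verified Lean document; each statement's English description precedes it below -/
import Mathlib

section
/- Let n ≥ 3 be a natural number and let m denote the binary length of n−1 (the number of digits in the binary representation of n−1). Define, for each assignment of binary variables x'₁, …, x'ₘ ∈ {0,1}, the value S(x') = Σ_{i=1}^{m−1} x'ᵢ·2^{i−1} + (n − 1 − Σ_{i=1}^{m−1} 2^{i−1})·x'ₘ. Then the set of values attained by S as x' ranges over all of {0,1}^m is exactly the set of all integers {0, 1, 2, …, n−1}. -/
theorem sum_binary_digits (t k : ℕ) :
    ∑ i : Fin k, t / 2 ^ (i : ℕ) % 2 * 2 ^ (i : ℕ) = t % 2 ^ k := by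
  induction k with
  | zero => simp [Nat.mod_one]
  | succ k ih =>
    rw [Fin.sum_univ_castSucc]
    simp only [Fin.val_castSucc, Fin.val_last]
    rw [ih, Nat.mod_pow_succ, mul_comm (2 ^ k)]

theorem sum_two_pow_add_one (k : ℕ) : ∑ i : Fin k, 2 ^ (i : ℕ) + 1 = 2 ^ k := by
  induction k with
  | zero => simp
  | succ k ih =>
    rw [Fin.sum_univ_castSucc]
    simp only [Fin.val_castSucc, Fin.val_last]
    rw [pow_succ]
    omega

/-- **Theorem 1 (slack-variable encoding).**
For `n ≥ 3`, with `m = bl(n-1)` the binary length of `n - 1`, the values of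
`S(x') = ∑_{i=1}^{m-1} x'ᵢ · 2^{i-1} + (n - 1 - ∑_{i=1}^{m-1} 2^{i-1}) · x'ₘ`,
as the binary variables `x'₁, …, x'ₘ ∈ {0,1}` range over all assignments,
are exactly the integers `{0, 1, …, n-1}`. -/
theorem slack_encoding_range (n : ℕ) (hn : 3 ≤ n) :
    {s : ℕ | ∃ x' : Fin (Nat.size (n - 1)) → ℕ, (∀ i, x' i ≤ 1) ∧
      s = (∑ i : Fin (Nat.size (n - 1) - 1),
            x' (Fin.castLE (Nat.sub_le _ 1) i) * 2 ^ (i : ℕ))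
          + (n - 1 - ∑ i : Fin (Nat.size (n - 1) - 1), 2 ^ (i : ℕ)) *
            x' ⟨Nat.size (n - 1) - 1, by
              have : 0 < Nat.size (n - 1) := Nat.size_pos.mpr (by omega)
              omega⟩} = Set.Iic (n - 1) := by
  have hpos : 0 < Nat.size (n - 1) := Nat.size_pos.mpr (by omega)
  have hlo : 2 ^ (Nat.size (n - 1) - 1) ≤ n - 1 := Nat.lt_size.mp (by omega)
  have hhi : n - 1 < 2 ^ (Nat.size (n - 1) - 1) * 2 := by
    rw [← pow_succ, Nat.sub_add_cancel hpos]
    exact Nat.lt_size_self _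
  have hsum := sum_two_pow_add_one (Nat.size (n - 1) - 1)
  ext s
  simp only [Set.mem_ofPred_eq, Set.mem_Iic]
  constructor
  · rintro ⟨x, hx, rfl⟩
    have hlow : ∑ i : Fin (Nat.size (n - 1) - 1),
        x (Fin.castLE (Nat.sub_le _ 1) i) * 2 ^ (i : ℕ) ≤
        ∑ i : Fin (Nat.size (n - 1) - 1), 2 ^ (i : ℕ) :=
      Finset.sum_le_sum fun i _ => mul_le_of_le_one_left (Nat.zero_le _) (hx _)
    have htop := mul_le_of_le_one_right
      (Nat.zero_le (n - 1 - ∑ i : Fin (Nat.size (n - 1) - 1), 2 ^ (i : ℕ)))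
      (hx ⟨Nat.size (n - 1) - 1, by omega⟩)
    omega
  · intro hs
    obtain ⟨b, t, hb, ht, rfl⟩ : ∃ b t, b ≤ 1 ∧ t < 2 ^ (Nat.size (n - 1) - 1) ∧
        s = t + (n - 1 - ∑ i : Fin (Nat.size (n - 1) - 1), 2 ^ (i : ℕ)) * b := by
      by_cases h : s < 2 ^ (Nat.size (n - 1) - 1)
      · exact ⟨0, s, by omega, h, by omega⟩
      · exact ⟨1, s - (n - 1 - ∑ i : Fin (Nat.size (n - 1) - 1), 2 ^ (i : ℕ)),
          by omega, by omega, by omega⟩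
    refine ⟨fun i => if (i : ℕ) = Nat.size (n - 1) - 1 then b else t / 2 ^ (i : ℕ) % 2,
      fun i => ?_, ?_⟩
    · dsimp only
      split_ifs <;> omega
    · simp only [Fin.val_castLE, Fin.is_lt, ne_of_lt, if_true, if_false]
      rw [sum_binary_digits, Nat.mod_eq_of_lt ht]
end

section
/- Let n ≥ 3, let m be the binary length of n−1, and for x' ∈ {0,1}^m define S(x') = Σ_{i=1}^{m−1} x'ᵢ·2^{i−1} + (n − 1 − Σ_{i=1}^{m−1} 2^{i−1})·x'ₘ. Then for all binary variables x₁, …, xₙ ∈ {0,1}: Σ_{i=1}^{n} xᵢ ≥ 1 holds if and only if there exists x' ∈ {0,1}^m such that Σ_{i=1}^{n} xᵢ − S(x') − 1 = 0. Consequently, the quadratic penalty P·(Σ xᵢ − S(x') − 1)² (for P > 0) can be made zero by a choice of slack bits x' exactly when the covering constraint Σ xᵢ ≥ 1 is satisfied. -/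
theorem sum_range_binary_digits (t k : ℕ) :
    ∑ i ∈ Finset.range k, (t / 2 ^ i % 2) * 2 ^ i = t % 2 ^ k := by
  induction k with
  | zero => simp [Nat.mod_one]
  | succ k ih => rw [Finset.sum_range_succ, ih, Nat.mod_pow_succ, mul_comm]

theorem exists_binary_sum_eq (t k : ℕ) (ht : t < 2 ^ k) :
    ∃ b : ℕ → ℤ, (∀ i, b i = 0 ∨ b i = 1) ∧ ∑ i : Fin k, b i * 2 ^ (i : ℕ) = t := by
  refine ⟨fun i => ((t / 2 ^ i % 2 : ℕ) : ℤ), fun i => by dsimp only; omega, ?_⟩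
  rw [Fin.sum_univ_eq_sum_range (fun i => ((t / 2 ^ i % 2 : ℕ) : ℤ) * 2 ^ i) k]
  have h := sum_range_binary_digits t k
  rw [Nat.mod_eq_of_lt ht] at h
  exact_mod_cast h

theorem sum_two_pow_fin (k : ℕ) : ∑ i : Fin k, (2 : ℤ) ^ (i : ℕ) = 2 ^ k - 1 := by
  rw [Fin.sum_univ_eq_sum_range (fun i => (2 : ℤ) ^ i) k]
  have h := geom_sum_mul (2 : ℤ) k
  linarith


/-- **Penalty correctness for the covering constraint.**
For `n ≥ 3`, `m = bl(n-1)`, and the slack encoding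
`S(x') = ∑_{i=1}^{m-1} x'ᵢ·2^{i-1} + (n - 1 - ∑_{i=1}^{m-1} 2^{i-1})·x'ₘ`,
for all binary `x₁, …, xₙ ∈ {0,1}` we have `∑ xᵢ ≥ 1` if and only if there is a
binary assignment `x' ∈ {0,1}^m` with `∑ xᵢ - S(x') - 1 = 0`. -/
theorem covering_constraint_iff_slack (n : ℕ) (hn : 3 ≤ n)
    (x : Fin n → ℤ) (hx : ∀ i, x i = 0 ∨ x i = 1) :
    1 ≤ ∑ i, x i ↔
      ∃ x' : Fin (Nat.size (n - 1)) → ℤ, (∀ i, x' i = 0 ∨ x' i = 1) ∧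
        (∑ i, x i) -
          ((∑ i : Fin (Nat.size (n - 1) - 1),
              x' (Fin.castLE (Nat.sub_le _ 1) i) * 2 ^ (i : ℕ))
            + ((n : ℤ) - 1 - ∑ i : Fin (Nat.size (n - 1) - 1), 2 ^ (i : ℕ)) *
              x' ⟨Nat.size (n - 1) - 1, by
                have : 0 < Nat.size (n - 1) := Nat.size_pos.mpr (by omega)
                omega⟩) - 1 = 0 := by
  have hsize : 0 < Nat.size (n - 1) := Nat.size_pos.mpr (by omega)
  have hlow : 2 ^ (Nat.size (n - 1) - 1) ≤ n - 1 := Nat.lt_size.mp (by omega)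
  have hhigh : n - 1 < 2 * 2 ^ (Nat.size (n - 1) - 1) := by
    rw [← pow_succ', Nat.sub_add_cancel hsize]
    exact Nat.lt_size_self _
  rw [sum_two_pow_fin]
  have hcast : (2 : ℤ) ^ (Nat.size (n - 1) - 1) = ((2 ^ (Nat.size (n - 1) - 1) : ℕ) : ℤ) := by
    push_cast
    rfl
  constructor
  · intro h
    have hle : ∑ i, x i ≤ n := by
      calc ∑ i, x i ≤ ∑ _i : Fin n, (1 : ℤ) :=
            Finset.sum_le_sum fun i _ => by rcases hx i with h | h <;> simp [h]
        _ = n := by simp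
    obtain ⟨t, ht⟩ := Int.eq_ofNat_of_zero_le (sub_nonneg.mpr h)
    suffices H : ∃ (r : ℕ) (e : ℤ), r < 2 ^ (Nat.size (n - 1) - 1) ∧ (e = 0 ∨ e = 1) ∧
        (t : ℤ) = r + ((n : ℤ) - 1 - (2 ^ (Nat.size (n - 1) - 1) - 1)) * e by
      obtain ⟨r, e, hr, he, hre⟩ := H
      obtain ⟨b, hb, hsum⟩ := exists_binary_sum_eq r _ hr
      refine ⟨fun i => if (i : ℕ) = Nat.size (n - 1) - 1 then e else b i, fun i => ?_, ?_⟩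
      · dsimp only
        split_ifs
        exacts [he, hb _]
      · simp only [Fin.val_castLE, Fin.is_lt, ne_of_lt, if_true, if_false]
        rw [hsum]
        linarith
    rw [hcast]
    generalize 2 ^ (Nat.size (n - 1) - 1) = M at *
    by_cases htM : t < M
    · exact ⟨t, 0, htM, Or.inl rfl, by simp⟩
    · exact ⟨t + M - n, 1, by omega, Or.inr rfl, by omega⟩
  · rintro ⟨x', hx', heq⟩
    have hsum : 0 ≤ ∑ i : Fin (Nat.size (n - 1) - 1),
        x' (Fin.castLE (Nat.sub_le _ 1) i) * 2 ^ (i : ℕ) :=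
      Finset.sum_nonneg fun i _ => mul_nonneg
        (by rcases hx' (Fin.castLE (Nat.sub_le _ 1) i) with h | h <;> simp [h]) (by positivity)
    have hlast : 0 ≤ x' ⟨Nat.size (n - 1) - 1, by omega⟩ := by
      rcases hx' ⟨Nat.size (n - 1) - 1, by omega⟩ with h | h <;> simp [h]
    have hcoef : 0 ≤ (n : ℤ) - 1 - (2 ^ (Nat.size (n - 1) - 1) - 1) := by
      rw [hcast]
      omega
    linarith [mul_nonneg hcoef hlast]
end
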